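/- arXiv:1307.7819 — 3 statements merged into one kernel-verified Lean document; each statement's English description precedes it below -/
import Mathlib

section
/- For 0 ≤ k ≤ n, the polynomial Q_{k,n}(z,z̄) := det M_{k,n}(z,z̄) / det M_{n−1} has the form z^{n−k} z̄^k plus a polynomial of total degree at most n−1 in (z,z̄); it satisfies ⟨Q_{k,n}, q⟩ = 0 for every polynomial q in (z,z̄) of total degree at most n−1 (so Q_{k,n} ∈ 𝒱_n²(w,ℂ)); and Q_{k,n}(z,z̄) = conj(Q_{n−k,n}(z,z̄)) for all z ∈ ℂ. -/
open MeasureTheory MvPolynomial Matrix Complex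
open scoped ComplexOrder

noncomputable section

/-- Evaluation of a polynomial in the two commuting variables `(z, z̄)` at a point `z ∈ ℂ`. -/
def evalz (p : MvPolynomial (Fin 2) ℂ) (z : ℂ) : ℂ :=
  MvPolynomial.eval (fun i : Fin 2 => if i = 0 then z else (starRingEnd ℂ) z) p

/-- The complex inner product `⟨f,g⟩ = ∫_Ω f conj(g) w`. -/
def cip (Ω : Set ℂ) (w : ℂ → ℝ) (p q : MvPolynomial (Fin 2) ℂ) : ℂ :=
  ∫ z in Ω, evalz p z * (starRingEnd ℂ) (evalz q z) * (w z : ℂ)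

/-- The monomial `z^a z̄^b` as a function on `ℂ`. -/
def mono (a b : ℕ) (z : ℂ) : ℂ := z ^ a * ((starRingEnd ℂ) z) ^ b

/-- Index set for the moment matrix `M_{n-1}`: pairs `(j,s)` with `0 ≤ s ≤ j ≤ n-1`;
it has cardinality `N = n(n+1)/2`. -/
abbrev Idx (n : ℕ) := (j : Fin n) × Fin (j.1+1)

/-- The moment matrix `M_{n-1}`, of size `N × N`, `N = n(n+1)/2`. -/
def Mlow (Ω : Set ℂ) (w : ℂ → ℝ) (n : ℕ) : Matrix (Idx n) (Idx n) ℂ :=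
  fun p q => ∫ z in Ω,
    mono (p.1.1 - p.2.1) p.2.1 z * (starRingEnd ℂ) (mono (q.1.1 - q.2.1) q.2.1 z) * (w z : ℂ)

/-- The `(N+1) × (N+1)` matrix `M_{k,n}(z,z̄)` with polynomial entries:
top-left block `M_{n-1}`, last column the moments `𝐦^n_{{j},k}`, last row the
monomials `(1, (𝐳¹)*, …, (𝐳^{n-1})*)`, and corner entry `z^{n-k} z̄^k`. -/
def Mkn (Ω : Set ℂ) (w : ℂ → ℝ) (n k : ℕ) :
    Matrix (Option (Idx n)) (Option (Idx n)) (MvPolynomial (Fin 2) ℂ) :=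
  fun p q =>
    match p, q with
    | some p, some q => C (Mlow Ω w n p q)
    | some p, none =>
        C (∫ z in Ω, mono (p.1.1 - p.2.1) p.2.1 z * mono (n - k) k z * (w z : ℂ))
    | none, some q => X 0 ^ q.2.1 * X 1 ^ (q.1.1 - q.2.1)
    | none, none => X 0 ^ (n - k) * X 1 ^ k

/-- The monic orthogonal polynomial `Q_{k,n} = det M_{k,n}(z,z̄) / det M_{n-1}`. -/
def Qdet (Ω : Set ℂ) (w : ℂ → ℝ) (n k : ℕ) : MvPolynomial (Fin 2) ℂ :=
  ((Mlow Ω w n).det)⁻¹ • (Mkn Ω w n k).det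

theorem evalz_add (p q : MvPolynomial (Fin 2) ℂ) (z : ℂ) :
    evalz (p + q) z = evalz p z + evalz q z := by simp [evalz]

theorem evalz_smul (c : ℂ) (p : MvPolynomial (Fin 2) ℂ) (z : ℂ) :
    evalz (c • p) z = c * evalz p z := by simp [evalz, smul_eval]

/-- The pairing `cip` as a sesquilinear form, given integrability of all the integrands. -/
def cipForm (Ω : Set ℂ) (w : ℂ → ℝ)
    (hInt : ∀ p q : MvPolynomial (Fin 2) ℂ,
      IntegrableOn (fun z => evalz p z * (starRingEnd ℂ) (evalz q z) * (w z : ℂ)) Ω) :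
    MvPolynomial (Fin 2) ℂ →ₗ[ℂ] MvPolynomial (Fin 2) ℂ →ₛₗ[starRingEnd ℂ] ℂ :=
  LinearMap.mk₂'ₛₗ (RingHom.id ℂ) (starRingEnd ℂ) (cip Ω w)
    (fun p p' q => by
      simp only [cip]
      rw [← integral_add (hInt p q) (hInt p' q)]
      exact integral_congr_ae (.of_forall fun z => by simp only [evalz_add]; ring))
    (fun c p q => by
      simp only [cip, RingHom.id_apply, smul_eq_mul]
      rw [← integral_const_mul]
      exact integral_congr_ae (.of_forall fun z => by simp only [evalz_smul]; ring))
    (fun p q q' => by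
      simp only [cip]
      rw [← integral_add (hInt p q) (hInt p q')]
      exact integral_congr_ae (.of_forall fun z => by simp only [evalz_add, map_add]; ring))
    (fun c p q => by
      simp only [cip, smul_eq_mul]
      rw [← integral_const_mul]
      exact integral_congr_ae (.of_forall fun z => by simp only [evalz_smul, map_mul]; ring))

/-- The polynomial `z^s z̄^(j-s)`, the entry of `(𝐳^j)*` at the index `(j,s)`. -/
def conjMonomial {n : ℕ} (p : Idx n) : MvPolynomial (Fin 2) ℂ :=
  X 0 ^ p.2.1 * X 1 ^ (p.1.1 - p.2.1)

theorem evalz_X_pow_mul (a b : ℕ) (z : ℂ) : evalz (X 0 ^ a * X 1 ^ b) z = mono a b z := by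
  simp [evalz, mono]

theorem conj_mono (a b : ℕ) (z : ℂ) : (starRingEnd ℂ) (mono a b z) = mono b a z := by
  simp [mono, mul_comm]

theorem evalz_conjMonomial {n : ℕ} (p : Idx n) (z : ℂ) :
    evalz (conjMonomial p) z = mono p.2.1 (p.1.1 - p.2.1) z := evalz_X_pow_mul _ _ _

theorem Mlow_eq_cip (Ω : Set ℂ) (w : ℂ → ℝ) (n : ℕ) (p q : Idx n) :
    Mlow Ω w n p q = cip Ω w (conjMonomial q) (conjMonomial p) := by
  simp only [Mlow, cip, evalz_conjMonomial, conj_mono]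
  exact integral_congr_ae (.of_forall fun z => by ring)

/-- The moment vector `∫ 𝐳^j z^a z̄^b w`, the last column of `Mkn`. -/
def momentColumn (Ω : Set ℂ) (w : ℂ → ℝ) (n a b : ℕ) (p : Idx n) : ℂ :=
  ∫ z in Ω, mono (p.1.1 - p.2.1) p.2.1 z * mono a b z * (w z : ℂ)

theorem momentColumn_eq_cip (Ω : Set ℂ) (w : ℂ → ℝ) (n a b : ℕ) (p : Idx n) :
    momentColumn Ω w n a b p = cip Ω w (X 0 ^ a * X 1 ^ b) (conjMonomial p) := by
  simp only [momentColumn, cip, evalz_conjMonomial, conj_mono, evalz_X_pow_mul]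
  exact integral_congr_ae (.of_forall fun z => by ring)

theorem X_pow_mul_eq_monomial (a b : ℕ) :
    (X 0 ^ a * X 1 ^ b : MvPolynomial (Fin 2) ℂ)
      = monomial (Finsupp.single 0 a + Finsupp.single 1 b) 1 := by
  simp [X_pow_eq_monomial, monomial_mul]

theorem linearIndependent_conjMonomial (n : ℕ) :
    LinearIndependent ℂ (conjMonomial : Idx n → MvPolynomial (Fin 2) ℂ) := by
  have hinj : Function.Injective (fun p : Idx n =>
      (Finsupp.single 0 p.2.1 + Finsupp.single 1 (p.1.1 - p.2.1) : Fin 2 →₀ ℕ)) := by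
    rintro ⟨⟨j, hj⟩, ⟨s, hs⟩⟩ ⟨⟨j', hj'⟩, ⟨s', hs'⟩⟩ h
    have h0 := DFunLike.congr_fun h 0
    have h1 := DFunLike.congr_fun h 1
    simp at h0 h1 hs hs'
    obtain rfl : s = s' := h0
    obtain rfl : j = j' := by omega
    rfl
  have h := (basisMonomials (Fin 2) ℂ).linearIndependent.comp _ hinj
  have hfun : (conjMonomial : Idx n → MvPolynomial (Fin 2) ℂ) =
      basisMonomials (Fin 2) ℂ ∘ fun p : Idx n =>
        (Finsupp.single 0 p.2.1 + Finsupp.single 1 (p.1.1 - p.2.1) : Fin 2 →₀ ℕ) := by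
    funext p
    simp [conjMonomial, X_pow_mul_eq_monomial]
  rw [hfun]
  exact h

theorem totalDegree_conjMonomial_lt {n : ℕ} (p : Idx n) :
    (conjMonomial p).totalDegree < n := by
  have h1 := p.1.2
  have h2 := p.2.2
  rw [conjMonomial, X_pow_mul_eq_monomial, totalDegree_monomial _ one_ne_zero,
    Finsupp.sum_fintype _ _ (by simp)]
  simp [Fin.sum_univ_two]
  omega

/-- Every polynomial of degree less than `n` is a combination of the monomials indexed by
`Idx n`. -/
theorem mem_span_conjMonomial {n : ℕ} {q : MvPolynomial (Fin 2) ℂ} (hq : q.totalDegree < n) :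
    q ∈ Submodule.span ℂ (Set.range (conjMonomial : Idx n → MvPolynomial (Fin 2) ℂ)) := by
  rw [← support_sum_monomial_coeff q]
  refine Submodule.sum_mem _ fun d hd => ?_
  have hdeg := (le_totalDegree hd).trans_lt hq
  rw [Finsupp.sum_fintype _ _ (by simp), Fin.sum_univ_two] at hdeg
  have hd : (Finsupp.single 0 (d 0) + Finsupp.single 1 (d 1) : Fin 2 →₀ ℕ) = d := by
    ext i
    fin_cases i <;> simp
  have hm : monomial d (coeff d q) = coeff d q •
      (conjMonomial (⟨⟨d 0 + d 1, hdeg⟩, ⟨d 0, by simp⟩⟩ : Idx n)) := by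
    simp [conjMonomial, X_pow_mul_eq_monomial, smul_monomial, hd]
  rw [hm]
  exact Submodule.smul_mem _ _ (Submodule.subset_span ⟨_, rfl⟩)

theorem cip_sum_conjMonomial {Ω : Set ℂ} {w : ℂ → ℝ}
    (hInt : ∀ p q : MvPolynomial (Fin 2) ℂ,
      IntegrableOn (fun z => evalz p z * (starRingEnd ℂ) (evalz q z) * (w z : ℂ)) Ω)
    {n : ℕ} (v : Idx n → ℂ) (p : Idx n) :
    cip Ω w (∑ q, v q • conjMonomial q) (conjMonomial p) = (Mlow Ω w n *ᵥ v) p := by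
  change cipForm Ω w hInt _ _ = _
  simp only [map_sum, map_smul, LinearMap.sum_apply, LinearMap.smul_apply, mulVec, dotProduct,
    Mlow_eq_cip]
  exact Finset.sum_congr rfl fun q _ => mul_comm _ _

theorem cip_eq_zero_of_forall_conjMonomial {Ω : Set ℂ} {w : ℂ → ℝ}
    (hInt : ∀ p q : MvPolynomial (Fin 2) ℂ,
      IntegrableOn (fun z => evalz p z * (starRingEnd ℂ) (evalz q z) * (w z : ℂ)) Ω)
    {n : ℕ} {r q : MvPolynomial (Fin 2) ℂ}
    (hr : ∀ p : Idx n, cip Ω w r (conjMonomial p) = 0)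
    (hq : q ∈ Submodule.span ℂ (Set.range (conjMonomial : Idx n → MvPolynomial (Fin 2) ℂ))) :
    cip Ω w r q = 0 := by
  change q ∈ LinearMap.ker (cipForm Ω w hInt r)
  refine Submodule.span_le.2 ?_ hq
  rintro _ ⟨p, rfl⟩
  exact hr p

theorem det_Mlow_ne_zero {Ω : Set ℂ} {w : ℂ → ℝ}
    (hInt : ∀ p q : MvPolynomial (Fin 2) ℂ,
      IntegrableOn (fun z => evalz p z * (starRingEnd ℂ) (evalz q z) * (w z : ℂ)) Ω)
    (hpos : ∀ p : MvPolynomial (Fin 2) ℂ, p ≠ 0 → 0 < cip Ω w p p)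
    (n : ℕ) : (Mlow Ω w n).det ≠ 0 := by
  intro h
  obtain ⟨v, hv, hMv⟩ := exists_mulVec_eq_zero_iff.2 h
  have hP : ∑ q, v q • conjMonomial q ≠ 0 := fun h0 =>
    hv (funext (Fintype.linearIndependent_iff.1 (linearIndependent_conjMonomial n) v h0))
  refine (hpos _ hP).ne' (cip_eq_zero_of_forall_conjMonomial hInt (n := n) (fun p => ?_) ?_)
  · rw [cip_sum_conjMonomial hInt, hMv, Pi.zero_apply]
  · exact Submodule.sum_mem _ fun q _ => Submodule.smul_mem _ _ (Submodule.subset_span ⟨q, rfl⟩)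

theorem Qdet_eq {Ω : Set ℂ} {w : ℂ → ℝ} {n : ℕ} (k : ℕ) (hdet : (Mlow Ω w n).det ≠ 0) :
    Qdet Ω w n k = X 0 ^ (n - k) * X 1 ^ k
      - ∑ q, ((Mlow Ω w n)⁻¹ *ᵥ momentColumn Ω w n (n - k) k) q • conjMonomial q := by
  set G := Mlow Ω w n with hG
  set c := momentColumn Ω w n (n - k) k with hc
  have hGu : IsUnit G.det := hdet.isUnit
  have hinv : G.map (C : ℂ →+* MvPolynomial (Fin 2) ℂ) * G⁻¹.map C = 1 := by
    rw [← Matrix.map_mul, mul_nonsing_inv _ hGu, Matrix.map_one _ C_0 C_1]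
  let _ : Invertible (G.map (C : ℂ →+* MvPolynomial (Fin 2) ℂ)) :=
    invertibleOfRightInverse _ _ hinv
  have hblock : Mkn Ω w n k = (fromBlocks (G.map (C : ℂ →+* MvPolynomial (Fin 2) ℂ))
      (of fun p (_ : Unit) => C (c p)) (of fun _ q => conjMonomial q)
      (of fun _ _ => X 0 ^ (n - k) * X 1 ^ k)).submatrix
        (Equiv.optionEquivSumPUnit _) (Equiv.optionEquivSumPUnit _) := by
    ext1 p q
    rcases p with _ | p <;> rcases q with _ | q <;>
      simp [Mkn, hG, hc, momentColumn, conjMonomial]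
  have hGdet : (G.map (C : ℂ →+* MvPolynomial (Fin 2) ℂ)).det = C G.det :=
    (RingHom.map_det C G).symm
  rw [Qdet, hblock, det_submatrix_equiv_self, det_fromBlocks₁₁, hGdet, ← smul_eq_C_mul,
    smul_smul, inv_mul_cancel₀ hdet, one_smul, det_unique]
  have hi : ⅟(G.map (C : ℂ →+* MvPolynomial (Fin 2) ℂ)) = G⁻¹.map C := rfl
  rw [hi, Matrix.mul_assoc]
  simp only [Matrix.sub_apply, of_apply, Matrix.mul_apply, map_apply, mulVec, dotProduct,
    smul_eq_C_mul, map_sum, map_mul]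
  congr 1
  exact Finset.sum_congr rfl fun q _ => mul_comm _ _

/-- The involution `(j,s) ↦ (j,j-s)`, which conjugates the monomials. -/
def idxConj (n : ℕ) : Idx n ≃ Idx n := Equiv.sigmaCongrRight fun _ => Fin.revPerm

theorem idxConj_mk {n : ℕ} (j : Fin n) (s : Fin (j.1 + 1)) :
    idxConj n ⟨j, s⟩ = ⟨j, s.rev⟩ := rfl

theorem conj_integral_mul_weight {Ω : Set ℂ} {w : ℂ → ℝ} (f : ℂ → ℂ) :
    (starRingEnd ℂ) (∫ z in Ω, f z * (w z : ℂ)) = ∫ z in Ω, (starRingEnd ℂ) (f z) * (w z : ℂ) := by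
  rw [← integral_conj]
  simp

theorem conj_Mlow (Ω : Set ℂ) (w : ℂ → ℝ) (n : ℕ) (p q : Idx n) :
    (starRingEnd ℂ) (Mlow Ω w n p q) = Mlow Ω w n (idxConj n p) (idxConj n q) := by
  rcases p with ⟨j, s⟩
  rcases q with ⟨i, t⟩
  have hs : j.1 - (j.1 - s.1) = s.1 := by omega
  have ht : i.1 - (i.1 - t.1) = t.1 := by omega
  simp [Mlow, conj_integral_mul_weight, conj_mono, idxConj_mk, Fin.val_rev, hs, ht]

theorem conj_det_Mlow (Ω : Set ℂ) (w : ℂ → ℝ) (n : ℕ) :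
    (starRingEnd ℂ) (Mlow Ω w n).det = (Mlow Ω w n).det := by
  rw [RingHom.map_det, ← det_submatrix_equiv_self (idxConj n) (Mlow Ω w n)]
  congr 1
  ext p q
  exact conj_Mlow Ω w n p q

theorem evalz_Qdet (Ω : Set ℂ) (w : ℂ → ℝ) (n k : ℕ) (z : ℂ) :
    evalz (Qdet Ω w n k) z
      = (Mlow Ω w n).det⁻¹ * (of fun p q => evalz (Mkn Ω w n k p q) z).det := by
  rw [Qdet, evalz_smul, evalz, RingHom.map_det]
  rfl

theorem evalz_Qdet_eq_conj (Ω : Set ℂ) (w : ℂ → ℝ) {n k : ℕ} (hk : k ≤ n) (z : ℂ) :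
    evalz (Qdet Ω w n k) z = (starRingEnd ℂ) (evalz (Qdet Ω w n (n - k)) z) := by
  have hnk : n - (n - k) = k := by omega
  rw [evalz_Qdet, evalz_Qdet, map_mul, map_inv₀, conj_det_Mlow, RingHom.map_det,
    ← det_submatrix_equiv_self (idxConj n).optionCongr (of fun p q => evalz (Mkn Ω w n k p q) z)]
  congr 2
  ext p q
  have hC (c : ℂ) : evalz (C c) z = c := by simp [evalz]
  rcases p with _ | p <;> rcases q with _ | q
  · simp [Mkn, evalz_X_pow_mul, conj_mono, hnk]
  · rcases q with ⟨i, t⟩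
    have ht : i.1 - (i.1 - t.1) = t.1 := by omega
    simp [Mkn, evalz_X_pow_mul, conj_mono, idxConj_mk, Fin.val_rev, ht]
  · rcases p with ⟨j, s⟩
    have hs : j.1 - (j.1 - s.1) = s.1 := by omega
    simp [Mkn, hC, conj_integral_mul_weight, conj_mono, idxConj_mk, Fin.val_rev, hs, hnk]
  · simp [Mkn, hC, conj_Mlow]

/-- For `0 ≤ k ≤ n`, the polynomial `Q_{k,n} = det M_{k,n}/det M_{n-1}`
equals `z^{n-k} z̄^k` plus a polynomial of total degree at most `n-1`; it is orthogonal to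
every polynomial of total degree at most `n-1` (so `Q_{k,n} ∈ 𝒱_n²(w,ℂ)`); and
`Q_{k,n}(z,z̄) = conj (Q_{n-k,n}(z,z̄))` for all `z ∈ ℂ`. -/
theorem stmt_2 (Ω : Set ℂ) (w : ℂ → ℝ)
    (hw : ∀ z ∈ Ω, 0 ≤ w z)
    (hnorm : (∫ z in Ω, w z) = 1)
    (hInt : ∀ p q : MvPolynomial (Fin 2) ℂ,
      IntegrableOn (fun z => evalz p z * (starRingEnd ℂ) (evalz q z) * (w z : ℂ)) Ω)
    (hpos : ∀ p : MvPolynomial (Fin 2) ℂ, p ≠ 0 → 0 < cip Ω w p p)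
    (n k : ℕ) (hk : k ≤ n) :
    (Qdet Ω w n k - X 0 ^ (n - k) * X 1 ^ k = 0 ∨
      (Qdet Ω w n k - X 0 ^ (n - k) * X 1 ^ k).totalDegree < n) ∧
    (∀ q : MvPolynomial (Fin 2) ℂ, q.totalDegree < n → cip Ω w (Qdet Ω w n k) q = 0) ∧
    (∀ z : ℂ, evalz (Qdet Ω w n k) z = (starRingEnd ℂ) (evalz (Qdet Ω w n (n - k)) z)) := by
  have hdet := det_Mlow_ne_zero hInt hpos n
  refine ⟨?_, fun q hq => ?_, evalz_Qdet_eq_conj Ω w hk⟩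
  · rw [Qdet_eq k hdet, sub_sub_cancel_left, neg_eq_zero, totalDegree_neg]
    rcases n.eq_zero_or_pos with rfl | hn
    · exact .inl (Finset.sum_eq_zero fun q _ => q.1.elim0)
    · refine .inr (lt_of_le_of_lt (totalDegree_finsetSum _ _) ?_)
      exact (Finset.sup_lt_iff hn).2 fun q _ =>
        (totalDegree_smul_le _ _).trans_lt (totalDegree_conjMonomial_lt q)
  · refine cip_eq_zero_of_forall_conjMonomial hInt (fun p => ?_) (mem_span_conjMonomial hq)
    have hsum := cip_sum_conjMonomial hInt
      ((Mlow Ω w n)⁻¹ *ᵥ momentColumn Ω w n (n - k) k) p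
    rw [mulVec_mulVec, mul_nonsing_inv _ hdet.isUnit, one_mulVec, momentColumn_eq_cip] at hsum
    have hsub := DFunLike.congr_fun ((cipForm Ω w hInt).map_sub (X 0 ^ (n - k) * X 1 ^ k)
      (∑ q, ((Mlow Ω w n)⁻¹ *ᵥ momentColumn Ω w n (n - k) k) q • conjMonomial q))
      (conjMonomial p)
    rw [Qdet_eq k hdet]
    exact hsub.trans (sub_eq_zero.2 hsum.symm)
end
end

section
/- For each n ≥ 0 let ℚ_n be (the vector of) a basis of 𝒱_n²(w,ℂ) satisfying ℚ_n = J_{n+1} conj(ℚ_n), with ℚ_0 = 1 and the convention ℚ_{−1} = 0. Then there exist complex matrices α_n of size (n+1)×(n+2), β_n of size (n+1)×(n+1), and γ_{n−1} of size (n+1)×n such that z ℚ_n(z,z̄) = α_n ℚ_{n+1}(z,z̄) + β_n ℚ_n(z,z̄) + γ_{n−1} ℚ_{n−1}(z,z̄) for all z, and, setting H_n := ∫_Ω ℚ_n ℚ_n* w dx dy, the coefficient γ satisfies γ_{n−1} H_{n−1} = J_{n+1} (α_{n−1} H_n)ᵀ J_n. -/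
open MeasureTheory MvPolynomial Matrix Complex
open scoped ComplexOrder

noncomputable section

/-- Conjugation of a polynomial in `(z, z̄)`: conjugate the coefficients and swap `z` and `z̄`. -/
def pconj (p : MvPolynomial (Fin 2) ℂ) : MvPolynomial (Fin 2) ℂ :=
  MvPolynomial.rename (Equiv.swap (0 : Fin 2) 1) (MvPolynomial.map (starRingEnd ℂ) p)
/-- Membership in `𝒱_n²(w,ℂ)`: total degree at most `n` and orthogonality to all
polynomials of total degree at most `n-1`. -/
def memV (Ω : Set ℂ) (w : ℂ → ℝ) (n : ℕ) (p : MvPolynomial (Fin 2) ℂ) : Prop :=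
  p.totalDegree ≤ n ∧ ∀ q : MvPolynomial (Fin 2) ℂ, q.totalDegree < n → cip Ω w p q = 0

/-- The `m × m` backward identity matrix. -/
def Jmat (m : ℕ) : Matrix (Fin m) (Fin m) ℂ :=
  fun r s => if r.1 + s.1 = m - 1 then 1 else 0

theorem evalz_pconj (p : MvPolynomial (Fin 2) ℂ) (z : ℂ) :
    evalz (pconj p) z = (starRingEnd ℂ) (evalz p z) := by
  unfold evalz pconj
  rw [eval_rename, eval_map, eval, coe_eval₂Hom,
    MvPolynomial.eval₂_comp_left (starRingEnd ℂ), RingHom.comp_id]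
  congr 1
  funext i
  fin_cases i <;> simp

theorem cip_conj_symm (Ω : Set ℂ) (w : ℂ → ℝ) (p q : MvPolynomial (Fin 2) ℂ) :
    (starRingEnd ℂ) (cip Ω w p q) = cip Ω w q p := by
  unfold cip
  rw [← integral_conj]
  congr 1
  funext z
  simp only [map_mul, Complex.conj_conj, Complex.conj_ofReal]
  ring

theorem cip_smul_left (Ω : Set ℂ) (w : ℂ → ℝ) (c : ℂ) (p q : MvPolynomial (Fin 2) ℂ) :
    cip Ω w (c • p) q = c * cip Ω w p q := by
  unfold cip
  rw [← integral_const_mul]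
  congr 1
  funext z
  rw [evalz_smul]
  ring

theorem cip_pconj (Ω : Set ℂ) (w : ℂ → ℝ) (p q : MvPolynomial (Fin 2) ℂ) :
    cip Ω w (pconj p) (pconj q) = cip Ω w q p := by
  unfold cip
  congr 1
  funext z
  rw [evalz_pconj, evalz_pconj, Complex.conj_conj]
  ring

theorem cip_X_mul_left (Ω : Set ℂ) (w : ℂ → ℝ) (p q : MvPolynomial (Fin 2) ℂ) :
    cip Ω w (X 0 * p) q = cip Ω w p (X 1 * q) := by
  unfold cip
  congr 1
  funext z
  simp only [evalz, map_mul, eval_X, if_true, one_ne_zero, if_false, Complex.conj_conj]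
  ring

theorem X_zero_mul_pconj (p : MvPolynomial (Fin 2) ℂ) :
    X 0 * pconj p = pconj (X 1 * p) := by
  simp [pconj]

/-- The pairing `cip` is additive in its first argument as soon as all moments exist. -/
theorem cip_add_left {Ω : Set ℂ} {w : ℂ → ℝ}
    (hInt : ∀ p q : MvPolynomial (Fin 2) ℂ,
      IntegrableOn (fun z => evalz p z * (starRingEnd ℂ) (evalz q z) * (w z : ℂ)) Ω)
    (p₁ p₂ q : MvPolynomial (Fin 2) ℂ) :
    cip Ω w (p₁ + p₂) q = cip Ω w p₁ q + cip Ω w p₂ q := by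
  unfold cip
  rw [← integral_add (hInt p₁ q) (hInt p₂ q)]
  congr 1
  funext z
  rw [evalz_add]
  ring

/-- `cip` as a linear functional of its first argument. -/
def cipLeft {Ω : Set ℂ} {w : ℂ → ℝ}
    (hInt : ∀ p q : MvPolynomial (Fin 2) ℂ,
      IntegrableOn (fun z => evalz p z * (starRingEnd ℂ) (evalz q z) * (w z : ℂ)) Ω)
    (q : MvPolynomial (Fin 2) ℂ) : MvPolynomial (Fin 2) ℂ →ₗ[ℂ] ℂ where
  toFun p := cip Ω w p q
  map_add' p₁ p₂ := cip_add_left hInt p₁ p₂ q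
  map_smul' c p := cip_smul_left Ω w c p q

/-- The inner product space structure that `cip` induces on polynomials. -/
@[reducible]
def cipCore {Ω : Set ℂ} {w : ℂ → ℝ}
    (hInt : ∀ p q : MvPolynomial (Fin 2) ℂ,
      IntegrableOn (fun z => evalz p z * (starRingEnd ℂ) (evalz q z) * (w z : ℂ)) Ω)
    (hpos : ∀ p : MvPolynomial (Fin 2) ℂ, p ≠ 0 → 0 < cip Ω w p p) :
    InnerProductSpace.Core ℂ (MvPolynomial (Fin 2) ℂ) where
  inner p q := cip Ω w q p
  conj_inner_symm p q := cip_conj_symm Ω w p q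
  re_inner_nonneg p := by
    by_cases hp : p = 0
    · have h := (cipLeft hInt p).map_zero
      subst hp
      exact (congrArg Complex.re h).ge
    · exact (Complex.lt_def.1 (hpos p hp)).1.le
  add_left p q r := by
    rw [← cip_conj_symm, cip_add_left hInt, map_add, cip_conj_symm, cip_conj_symm]
  smul_left p q c := by
    rw [← cip_conj_symm, cip_smul_left, map_mul, cip_conj_symm]
  definite p hp := by
    by_contra h
    exact (hpos p h).ne' hp

/-- Orthogonal projection of a polynomial onto those of total degree at most `n`. -/
theorem exists_memV_sub {Ω : Set ℂ} {w : ℂ → ℝ}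
    (hInt : ∀ p q : MvPolynomial (Fin 2) ℂ,
      IntegrableOn (fun z => evalz p z * (starRingEnd ℂ) (evalz q z) * (w z : ℂ)) Ω)
    (hpos : ∀ p : MvPolynomial (Fin 2) ℂ, p ≠ 0 → 0 < cip Ω w p p)
    {n : ℕ} {p : MvPolynomial (Fin 2) ℂ} (hp : p.totalDegree ≤ n + 1) :
    ∃ q : MvPolynomial (Fin 2) ℂ, q.totalDegree ≤ n ∧ memV Ω w (n + 1) (p - q) := by
  let _ : NormedAddCommGroup (MvPolynomial (Fin 2) ℂ) :=
    (cipCore hInt hpos).toNormedAddCommGroup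
  let _ : InnerProductSpace ℂ (MvPolynomial (Fin 2) ℂ) :=
    InnerProductSpace.ofCore (cipCore hInt hpos).toCore
  let K : Submodule ℂ (MvPolynomial (Fin 2) ℂ) := restrictTotalDegree (Fin 2) ℂ n
  have hfin : FiniteDimensional ℂ K :=
    inferInstanceAs (Module.Finite ℂ (restrictTotalDegree (Fin 2) ℂ n))
  have hK : (K.starProjection p).totalDegree ≤ n :=
    (mem_restrictTotalDegree _ _ _).1 (K.starProjection_apply_mem p)
  refine ⟨K.starProjection p, hK, ?_, fun q hq => ?_⟩
  · exact (totalDegree_sub _ _).trans (max_le hp (hK.trans n.le_succ))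
  · exact (K.mem_orthogonal _).1 (K.sub_starProjection_mem_orthogonal p) q
      ((mem_restrictTotalDegree _ _ _).2 (Nat.lt_succ_iff.1 hq))

theorem totalDegree_X_mul_le (i : Fin 2) {p : MvPolynomial (Fin 2) ℂ} {n : ℕ}
    (hp : p.totalDegree ≤ n) : (X i * p).totalDegree ≤ n + 1 := by
  have h := totalDegree_mul (X i) p
  rw [totalDegree_X] at h
  omega

theorem Jmat_apply {m : ℕ} (r s : Fin m) : Jmat m r s = if s = r.rev then 1 else 0 := by
  unfold Jmat
  congr 1
  rw [Fin.ext_iff, Fin.val_rev]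
  apply propext
  omega

theorem Jmat_mul_mul_Jmat_apply {m n : ℕ} (A : Matrix (Fin m) (Fin n) ℂ) (r : Fin m) (s : Fin n) :
    (Jmat m * A * Jmat n) r s = A r.rev s.rev := by
  simp only [Matrix.mul_apply, Jmat_apply, ite_mul, one_mul, zero_mul, Finset.sum_ite_eq',
    Finset.mem_univ, if_true]
  rw [Finset.sum_eq_single s.rev]
  · simp
  · intro x _ hx
    have h : s ≠ x.rev := fun h => hx (by rw [h, Fin.rev_rev])
    simp [h]
  · simp

theorem cip_sum_smul_left {Ω : Set ℂ} {w : ℂ → ℝ}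
    (hInt : ∀ p q : MvPolynomial (Fin 2) ℂ,
      IntegrableOn (fun z => evalz p z * (starRingEnd ℂ) (evalz q z) * (w z : ℂ)) Ω)
    {ι : Type*} [Fintype ι] (c : ι → ℂ) (P : ι → MvPolynomial (Fin 2) ℂ)
    (q : MvPolynomial (Fin 2) ℂ) :
    cip Ω w (∑ j, c j • P j) q = ∑ j, c j * cip Ω w (P j) q := by
  change cipLeft hInt q (∑ j, c j • P j) = ∑ j, c j * cipLeft hInt q (P j)
  simp only [map_sum, map_smul, smul_eq_mul]

theorem cip_sum_smul_eq_zero {Ω : Set ℂ} {w : ℂ → ℝ}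
    (hInt : ∀ p q : MvPolynomial (Fin 2) ℂ,
      IntegrableOn (fun z => evalz p z * (starRingEnd ℂ) (evalz q z) * (w z : ℂ)) Ω)
    {ι : Type*} [Fintype ι] (c : ι → ℂ) (P : ι → MvPolynomial (Fin 2) ℂ)
    (q : MvPolynomial (Fin 2) ℂ) (h : ∀ j, cip Ω w (P j) q = 0) :
    cip Ω w (∑ j, c j • P j) q = 0 := by
  rw [cip_sum_smul_left hInt]
  exact Finset.sum_eq_zero fun j _ => by rw [h j, mul_zero]

/-- Elements of `𝒱_n` and `𝒱_m` are orthogonal for `n < m`. -/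
theorem memV.cip_eq_zero_of_lt {Ω : Set ℂ} {w : ℂ → ℝ} {m n : ℕ} {p q : MvPolynomial (Fin 2) ℂ}
    (hp : memV Ω w m p) (hq : memV Ω w n q) (hnm : n < m) :
    cip Ω w p q = 0 ∧ cip Ω w q p = 0 := by
  have h := hp.2 q (hq.1.trans_lt hnm)
  exact ⟨h, by rw [← cip_conj_symm, h, map_zero]⟩

/-- **three-term relation.** If for each `n` the vector `ℚ_n` is a basis of
`𝒱_n²(w,ℂ)` satisfying `ℚ_n = J_{n+1} conj(ℚ_n)`, with `ℚ_0 = 1` (and `ℚ_{-1} = 0`), then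
there exist matrices `α_n ((n+1)×(n+2))`, `β_n ((n+1)×(n+1))`, `γ_{n-1} ((n+1)×n)` with
`z ℚ_n = α_n ℚ_{n+1} + β_n ℚ_n + γ_{n-1} ℚ_{n-1}` and, with `H_n = ∫ ℚ_n ℚ_n* w`,
`γ_{n-1} H_{n-1} = J_{n+1} (α_{n-1} H_n)ᵀ J_n`.  (Here `γ m` denotes `γ_m`, the matrix
appearing in the relation for `z ℚ_{m+1}`.) -/
theorem stmt_8 (Ω : Set ℂ) (w : ℂ → ℝ)
    (hw : ∀ z ∈ Ω, 0 ≤ w z)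
    (hnorm : (∫ z in Ω, w z) = 1)
    (hInt : ∀ p q : MvPolynomial (Fin 2) ℂ,
      IntegrableOn (fun z => evalz p z * (starRingEnd ℂ) (evalz q z) * (w z : ℂ)) Ω)
    (hpos : ∀ p : MvPolynomial (Fin 2) ℂ, p ≠ 0 → 0 < cip Ω w p p)
    (Q : (n : ℕ) → Fin (n+1) → MvPolynomial (Fin 2) ℂ)
    (hQ0 : Q 0 = fun _ => 1)
    (hmem : ∀ n k, memV Ω w n (Q n k))
    (hli : ∀ n, LinearIndependent ℂ (Q n))
    (hspan : ∀ n p, memV Ω w n p → p ∈ Submodule.span ℂ (Set.range (Q n)))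
    (hsymm : ∀ n (k : Fin (n+1)), Q n k = pconj (Q n k.rev)) :
    ∃ (α : (n : ℕ) → Matrix (Fin (n+1)) (Fin (n+2)) ℂ)
      (β : (n : ℕ) → Matrix (Fin (n+1)) (Fin (n+1)) ℂ)
      (γ : (n : ℕ) → Matrix (Fin (n+2)) (Fin (n+1)) ℂ),
      (∀ k, X 0 * Q 0 k = ∑ j, α 0 k j • Q 1 j + ∑ j, β 0 k j • Q 0 j) ∧
      (∀ n (k : Fin (n+2)), X 0 * Q (n+1) k =
        ∑ j, α (n+1) k j • Q (n+2) j + ∑ j, β (n+1) k j • Q (n+1) j + ∑ j, γ n k j • Q n j) ∧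
      (∀ n, γ n * (Matrix.of fun k j => cip Ω w (Q n k) (Q n j)) =
        Jmat (n+2) * (α n * (Matrix.of fun k j => cip Ω w (Q (n+1) k) (Q (n+1) j)))ᵀ
          * Jmat (n+1)) := by
  have coeffs : ∀ n p, memV Ω w n p → ∃ c : Fin (n + 1) → ℂ, ∑ j, c j • Q n j = p :=
    fun n p hp => Submodule.mem_span_range_iff_exists_fun ℂ |>.1 (hspan n p hp)
  have base : ∀ k, ∃ (a : Fin 2 → ℂ) (b : Fin 1 → ℂ),
      X 0 * Q 0 k = ∑ j, a j • Q 1 j + ∑ j, b j • Q 0 j := by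
    intro k
    obtain ⟨q, hq, hv⟩ := exists_memV_sub hInt hpos (totalDegree_X_mul_le 0 (hmem 0 k).1)
    obtain ⟨a, ha⟩ := coeffs 1 _ hv
    obtain ⟨b, hb⟩ := coeffs 0 q ⟨hq, fun _ h => absurd h (Nat.not_lt_zero _)⟩
    exact ⟨a, b, by rw [ha, hb, sub_add_cancel]⟩
  have step : ∀ n (k : Fin (n + 2)), ∃ (a : Fin (n + 3) → ℂ) (b : Fin (n + 2) → ℂ)
      (c : Fin (n + 1) → ℂ), X 0 * Q (n + 1) k =
        ∑ j, a j • Q (n + 2) j + ∑ j, b j • Q (n + 1) j + ∑ j, c j • Q n j := by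
    intro n k
    obtain ⟨q, hq, hv⟩ := exists_memV_sub hInt hpos (totalDegree_X_mul_le 0 (hmem (n + 1) k).1)
    obtain ⟨r, hr, hu⟩ := exists_memV_sub hInt hpos hq
    have hrV : memV Ω w n r := by
      refine ⟨hr, fun s hs => ?_⟩
      have h₁ : cip Ω w (X 0 * Q (n + 1) k) s = 0 := by
        rw [cip_X_mul_left]
        exact (hmem (n + 1) k).2 _ ((totalDegree_X_mul_le 1 le_rfl).trans_lt (by omega))
      have h₂ := hv.2 s (by omega)
      have h₃ := hu.2 s (by omega)
      have h₄ : X 0 * Q (n + 1) k = (X 0 * Q (n + 1) k - q) + (q - r) + r := by ring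
      rw [h₄, cip_add_left hInt, cip_add_left hInt, h₂, h₃, zero_add, zero_add] at h₁
      exact h₁
    obtain ⟨a, ha⟩ := coeffs (n + 2) _ hv
    obtain ⟨b, hb⟩ := coeffs (n + 1) _ hu
    obtain ⟨c, hc⟩ := coeffs n _ hrV
    exact ⟨a, b, c, by rw [ha, hb, hc]; ring⟩
  choose a₀ b₀ h₀ using base
  choose a b c h using step
  let α : (n : ℕ) → Matrix (Fin (n+1)) (Fin (n+2)) ℂ
    | 0 => a₀
    | n + 1 => a n
  let β : (n : ℕ) → Matrix (Fin (n+1)) (Fin (n+1)) ℂ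
    | 0 => b₀
    | n + 1 => b n
  refine ⟨α, β, fun n => Matrix.of (c n), h₀, h, fun n => ?_⟩
  have orth : ∀ {m n : ℕ} (i j), n < m →
      cip Ω w (Q m i) (Q n j) = 0 ∧ cip Ω w (Q n j) (Q m i) = 0 :=
    fun {m n} i j hnm => (hmem m i).cip_eq_zero_of_lt (hmem n j) hnm
  have hα : ∀ i l, (α n * (Matrix.of fun k j => cip Ω w (Q (n+1) k) (Q (n+1) j))) i l =
      cip Ω w (X 0 * Q n i) (Q (n + 1) l) := by
    intro i l
    rw [Matrix.mul_apply]
    simp only [Matrix.of_apply]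
    rw [← cip_sum_smul_left hInt]
    cases n with
    | zero =>
      rw [h₀, cip_add_left hInt, cip_sum_smul_eq_zero hInt (b₀ i) _ _
        fun j => (orth _ _ (by omega)).2, add_zero]
    | succ n =>
      rw [h, cip_add_left hInt, cip_add_left hInt,
        cip_sum_smul_eq_zero hInt (b n i) _ _ fun j => (orth _ _ (by omega)).2,
        cip_sum_smul_eq_zero hInt (c n i) _ _ fun j => (orth _ _ (by omega)).2,
        add_zero, add_zero]
  ext k j
  rw [Jmat_mul_mul_Jmat_apply, Matrix.transpose_apply, hα, hsymm n j.rev, Fin.rev_rev,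
    hsymm (n + 1) k.rev, Fin.rev_rev, X_zero_mul_pconj, cip_pconj, ← cip_X_mul_left, h,
    cip_add_left hInt, cip_add_left hInt,
    cip_sum_smul_eq_zero hInt (a n k) _ _ fun i => (orth _ _ (by omega)).1,
    cip_sum_smul_eq_zero hInt (b n k) _ _ fun i => (orth _ _ (by omega)).1,
    zero_add, zero_add, cip_sum_smul_left hInt, Matrix.mul_apply]
  rfl
end
end

section
/- Suppose for each n the basis ℚ_n of 𝒱_n²(w,ℂ) satisfies ℚ_n = J_{n+1} conj(ℚ_n) and the three-term relation z ℚ_n = α_n ℚ_{n+1} + β_n ℚ_n + γ_{n−1} ℚ_{n−1}. Then it also satisfies the conjugate three-term relation z̄ ℚ_n(z,z̄) = α_n^∨ ℚ_{n+1}(z,z̄) + β_n^∨ ℚ_n(z,z̄) + γ_{n−1}^∨ ℚ_{n−1}(z,z̄), where for an n×m complex matrix M one sets M^∨ := J_n conj(M) J_m. -/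
open MeasureTheory MvPolynomial Matrix Complex
open scoped ComplexOrder

noncomputable section

/-- `M^∨ = J_a conj(M) J_b` for an `a × b` complex matrix `M`. -/
def vee {a b : ℕ} (M : Matrix (Fin a) (Fin b) ℂ) : Matrix (Fin a) (Fin b) ℂ :=
  Jmat a * M.map (starRingEnd ℂ) * Jmat b

theorem vee_apply {a b : ℕ} (M : Matrix (Fin a) (Fin b) ℂ) (i : Fin a) (j : Fin b) :
    vee M i j = (starRingEnd ℂ) (M i.rev j.rev) := by
  have hJ : ∀ {m : ℕ} (r s : Fin m), Jmat m r s = if s = r.rev then 1 else 0 := by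
    intro m r s
    have h : r.1 + s.1 = m - 1 ↔ s = r.rev := by
      rw [Fin.ext_iff, Fin.val_rev]
      omega
    simp only [Jmat, h]
  have hrev : ∀ x : Fin b, j = x.rev ↔ x = j.rev := fun x => by
    rw [eq_comm, Fin.rev_eq_iff]
  simp [vee, Matrix.mul_apply, hJ, hrev]

theorem pconj_add (p q : MvPolynomial (Fin 2) ℂ) : pconj (p + q) = pconj p + pconj q := by
  simp [pconj]

theorem pconj_mul (p q : MvPolynomial (Fin 2) ℂ) : pconj (p * q) = pconj p * pconj q := by
  simp [pconj]

theorem pconj_X_zero : pconj (X 0) = X 1 := by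
  simp [pconj]

theorem pconj_sum_smul {ι : Type*} (s : Finset ι) (c : ι → ℂ) (p : ι → MvPolynomial (Fin 2) ℂ) :
    pconj (∑ j ∈ s, c j • p j) = ∑ j ∈ s, (starRingEnd ℂ) (c j) • pconj (p j) := by
  simp [pconj, MvPolynomial.smul_eq_C_mul]

/-- If `Q = J conj(Q)`, then conjugating row `k.rev` of `M Q` gives row `k` of `M^∨ Q`. -/
theorem pconj_sum_rev {a b : ℕ} (M : Matrix (Fin a) (Fin b) ℂ)
    (Q : Fin b → MvPolynomial (Fin 2) ℂ) (hQ : ∀ j, Q j = pconj (Q j.rev)) (k : Fin a) :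
    pconj (∑ j, M k.rev j • Q j) = ∑ j, vee M k j • Q j := by
  rw [pconj_sum_smul, ← Equiv.sum_comp Fin.revPerm]
  refine Finset.sum_congr rfl fun j _ => ?_
  rw [Fin.revPerm_apply, vee_apply, ← hQ j]

/-- If for each `n` the basis `ℚ_n` of `𝒱_n²(w,ℂ)` satisfies
`ℚ_n = J_{n+1} conj(ℚ_n)` and the three-term relation
`z ℚ_n = α_n ℚ_{n+1} + β_n ℚ_n + γ_{n-1} ℚ_{n-1}`, then it also satisfies the conjugate
relation `z̄ ℚ_n = α_n^∨ ℚ_{n+1} + β_n^∨ ℚ_n + γ_{n-1}^∨ ℚ_{n-1}` where `M^∨ = J conj(M) J`.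
(Here `γ m` denotes `γ_m`, the matrix appearing in the relation for `z ℚ_{m+1}`.) -/
theorem stmt_9 (Ω : Set ℂ) (w : ℂ → ℝ)
    (hw : ∀ z ∈ Ω, 0 ≤ w z)
    (hnorm : (∫ z in Ω, w z) = 1)
    (hInt : ∀ p q : MvPolynomial (Fin 2) ℂ,
      IntegrableOn (fun z => evalz p z * (starRingEnd ℂ) (evalz q z) * (w z : ℂ)) Ω)
    (hpos : ∀ p : MvPolynomial (Fin 2) ℂ, p ≠ 0 → 0 < cip Ω w p p)
    (Q : (n : ℕ) → Fin (n+1) → MvPolynomial (Fin 2) ℂ)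
    (hmem : ∀ n k, memV Ω w n (Q n k))
    (hli : ∀ n, LinearIndependent ℂ (Q n))
    (hspan : ∀ n p, memV Ω w n p → p ∈ Submodule.span ℂ (Set.range (Q n)))
    (hsymm : ∀ n (k : Fin (n+1)), Q n k = pconj (Q n k.rev))
    (α : (n : ℕ) → Matrix (Fin (n+1)) (Fin (n+2)) ℂ)
    (β : (n : ℕ) → Matrix (Fin (n+1)) (Fin (n+1)) ℂ)
    (γ : (n : ℕ) → Matrix (Fin (n+2)) (Fin (n+1)) ℂ)
    (hrel0 : ∀ k, X 0 * Q 0 k = ∑ j, α 0 k j • Q 1 j + ∑ j, β 0 k j • Q 0 j)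
    (hrel : ∀ n (k : Fin (n+2)), X 0 * Q (n+1) k =
      ∑ j, α (n+1) k j • Q (n+2) j + ∑ j, β (n+1) k j • Q (n+1) j + ∑ j, γ n k j • Q n j) :
    (∀ k, X 1 * Q 0 k = ∑ j, vee (α 0) k j • Q 1 j + ∑ j, vee (β 0) k j • Q 0 j) ∧
    (∀ n (k : Fin (n+2)), X 1 * Q (n+1) k =
      ∑ j, vee (α (n+1)) k j • Q (n+2) j + ∑ j, vee (β (n+1)) k j • Q (n+1) j
        + ∑ j, vee (γ n) k j • Q n j) := by
  refine ⟨fun k => ?_, fun n k => ?_⟩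
  · rw [← pconj_sum_rev _ _ (hsymm 1), ← pconj_sum_rev _ _ (hsymm 0), ← pconj_add, ← hrel0,
      pconj_mul, pconj_X_zero, ← hsymm]
  · rw [← pconj_sum_rev _ _ (hsymm (n + 2)), ← pconj_sum_rev _ _ (hsymm (n + 1)),
      ← pconj_sum_rev _ _ (hsymm n), ← pconj_add, ← pconj_add, ← hrel,
      pconj_mul, pconj_X_zero, ← hsymm]
end
end
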